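/- arXiv:1808.00825 — 6 statements merged into one kernel-verified Lean document; each statement's English description precedes it below -/
import Mathlib

section
/- Let G be a finite simple graph on vertex set V and let W ⊆ V be a set of minimum cardinality among all sets satisfying q(V∖W) > |W|. Then every vertex v ∈ W has neighbors in at least 3 distinct connected components of the induced subgraph G[V∖W]. -/
open SimpleGraph

/-- `q(V∖W)`: the number of connected components of the induced subgraph `G[V∖W]`
that have an odd number of vertices. -/
noncomputable def oddComponents {V : Type*} [Fintype V] (G : SimpleGraph V)
    (W : Finset V) : ℕ :=
  Nat.card {c : (G.induce ((↑W : Set V)ᶜ)).ConnectedComponent // Odd (Nat.card c.supp)}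

section AddVertex

variable {V : Type*} (G : SimpleGraph V) (A : Set V) (v : V)

/-- The components of `G[A]` containing a neighbour of `v`. -/
def adjacentComponents : Set (G.induce A).ConnectedComponent :=
  {c | ∃ u : A, G.Adj v u ∧ (G.induce A).connectedComponentMk u = c}

/-- The embedding of `G[A]` into `G[A ∪ {v}]`. -/
def induceInsertHom : G.induce A →g G.induce (insert v A) :=
  (induceHomOfLE G (Set.subset_insert v A)).toHom

lemma SimpleGraph.Reachable.mem_of_adj_closed {α : Type*} {H : SimpleGraph α} {S : Set α}
    (hS : ∀ x ∈ S, ∀ y, H.Adj x y → y ∈ S) {x y : α} (h : H.Reachable x y) (hx : x ∈ S) :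
    y ∈ S := by
  obtain ⟨p⟩ := h
  induction p with
  | nil => exact hx
  | cons hadj _ ih => exact ih (hS _ hx _ hadj)

lemma induceInsertHom_injective : Function.Injective (induceInsertHom G A v) :=
  (induceHomOfLE G (Set.subset_insert v A)).injective

lemma supp_map_induceInsertHom {c : (G.induce A).ConnectedComponent}
    (hc : c ∉ adjacentComponents G A v) :
    (c.map (induceInsertHom G A v)).supp = induceInsertHom G A v '' c.supp := by
  induction c using ConnectedComponent.ind with | _ u
  ext y
  constructor
  · intro hy
    rw [ConnectedComponent.map_mk, ConnectedComponent.mem_supp_iff, ConnectedComponent.eq] at hy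
    refine hy.symm.mem_of_adj_closed ?_ ⟨u, rfl, rfl⟩
    rintro _ ⟨x, hx, rfl⟩ ⟨y, hy⟩ hxy
    have hxy' : G.Adj x y := hxy
    rcases hy with rfl | hy
    · exact absurd ⟨x, hxy'.symm, hx⟩ hc
    · refine ⟨⟨y, hy⟩, ?_, rfl⟩
      rw [ConnectedComponent.mem_supp_iff] at hx ⊢
      rw [← hx, ConnectedComponent.eq]
      exact (Adj.reachable (show (G.induce A).Adj x ⟨y, hy⟩ from hxy')).symm
  · rintro ⟨x, hx, rfl⟩
    rw [ConnectedComponent.mem_supp_iff] at hx ⊢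
    rw [← hx, ConnectedComponent.map_mk]

lemma supp_connectedComponentMk_insert :
    ((G.induce (insert v A)).connectedComponentMk ⟨v, Set.mem_insert v A⟩).supp =
      insert ⟨v, Set.mem_insert v A⟩
        (induceInsertHom G A v '' ⋃ c ∈ adjacentComponents G A v, c.supp) := by
  ext y
  constructor
  · intro hy
    rw [ConnectedComponent.mem_supp_iff, ConnectedComponent.eq] at hy
    refine hy.symm.mem_of_adj_closed ?_ (Set.mem_insert _ _)
    rintro x hx ⟨y, hy⟩ hxy
    by_cases hyv : y = v
    · subst hyv
      exact Set.mem_insert _ _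
    have hyA : y ∈ A := hy.resolve_left hyv
    refine Or.inr ⟨⟨y, hyA⟩, ?_, rfl⟩
    rcases hx with rfl | ⟨x, hx, rfl⟩
    · exact Set.mem_biUnion (x := (G.induce A).connectedComponentMk ⟨y, hyA⟩)
        ⟨⟨y, hyA⟩, hxy, rfl⟩ rfl
    · simp only [Set.mem_iUnion] at hx ⊢
      obtain ⟨c, hc, hxc⟩ := hx
      refine ⟨c, hc, ?_⟩
      rw [ConnectedComponent.mem_supp_iff] at hxc ⊢
      rw [← hxc, ConnectedComponent.eq]
      exact (Adj.reachable (show (G.induce A).Adj x ⟨y, hyA⟩ from hxy)).symm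
  · rintro (rfl | ⟨x, hx, rfl⟩)
    · rfl
    · simp only [Set.mem_iUnion] at hx
      obtain ⟨_, ⟨u, hvu, rfl⟩, hxu⟩ := hx
      rw [ConnectedComponent.mem_supp_iff, ConnectedComponent.eq] at hxu ⊢
      exact (hxu.map (induceInsertHom G A v)).trans
        (Adj.reachable (show (G.induce (insert v A)).Adj (induceInsertHom G A v u)
          ⟨v, Set.mem_insert v A⟩ from hvu.symm))

variable {A v}

lemma map_induceInsertHom_ne (hv : v ∉ A) {c : (G.induce A).ConnectedComponent}
    (hc : c ∉ adjacentComponents G A v) :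
    c.map (induceInsertHom G A v) ≠
      (G.induce (insert v A)).connectedComponentMk ⟨v, Set.mem_insert v A⟩ := by
  intro h
  have hmem : (⟨v, Set.mem_insert v A⟩ : (insert v A : Set V)) ∈
      (c.map (induceInsertHom G A v)).supp := h.symm
  rw [supp_map_induceInsertHom G A v hc] at hmem
  obtain ⟨x, -, hx⟩ := hmem
  have hxv : (x : V) = v := congrArg Subtype.val hx
  exact hv (hxv ▸ x.2)

lemma injOn_map_induceInsertHom :
    Set.InjOn (ConnectedComponent.map (induceInsertHom G A v)) (adjacentComponents G A v)ᶜ := by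
  intro c hc d hd h
  apply ConnectedComponent.supp_injective
  apply (induceInsertHom_injective G A v).image_injective
  rw [← supp_map_induceInsertHom G A v hc, ← supp_map_induceInsertHom G A v hd, h]

lemma ncard_oddComponents_le_insert [Finite V] (hv : v ∉ A)
    (hT : (adjacentComponents G A v).ncard ≤ 2) :
    (G.induce A).oddComponents.ncard ≤ (G.induce (insert v A)).oddComponents.ncard + 1 := by
  set T := adjacentComponents G A v with hTdef
  set O := (G.induce A).oddComponents with hO
  set F := ConnectedComponent.map (induceInsertHom G A v) with hF
  have hsub : F '' (O \ T) ⊆ (G.induce (insert v A)).oddComponents := by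
    rintro _ ⟨c, ⟨hcO, hcT⟩, rfl⟩
    change Odd (Set.ncard _)
    rw [supp_map_induceInsertHom G A v hcT,
      Set.ncard_image_of_injective _ (induceInsertHom_injective G A v)]
    exact hcO
  have himg : (F '' (O \ T)).ncard = (O \ T).ncard :=
    Set.InjOn.ncard_image ((injOn_map_induceInsertHom G).mono fun _ h => h.2)
  have hsplit : (O ∩ T).ncard + (O \ T).ncard = O.ncard :=
    Set.ncard_inter_add_ncard_sdiff_eq_ncard O T
  by_cases h1 : (O ∩ T).ncard ≤ 1
  · have := Set.ncard_le_ncard hsub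
    lia
  have hTO : O ∩ T = T := Set.eq_of_subset_of_ncard_le Set.inter_subset_right (by lia)
  have hT2 : T.ncard = 2 := by rw [hTO] at h1; lia
  obtain ⟨a, b, hab, hTab⟩ := Set.ncard_eq_two.1 hT2
  have ha : Odd a.supp.ncard := (hTO.ge (by simp [hTab] : a ∈ T)).1
  have hb : Odd b.supp.ncard := (hTO.ge (by simp [hTab] : b ∈ T)).1
  set C := (G.induce (insert v A)).connectedComponentMk ⟨v, Set.mem_insert v A⟩ with hC
  have hCodd : C ∈ (G.induce (insert v A)).oddComponents := by
    change Odd (Set.ncard _)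
    rw [hC, supp_connectedComponentMk_insert, Set.ncard_insert_of_notMem,
      Set.ncard_image_of_injective _ (induceInsertHom_injective G A v), ← hTdef, hTab,
      Set.biUnion_pair, Set.ncard_union_eq]
    · exact (ha.add_odd hb).add_one
    · exact pairwise_disjoint_supp_connectedComponent _ hab
    · rintro ⟨x, -, hx⟩
      have hxv : (x : V) = v := congrArg Subtype.val hx
      exact hv (hxv ▸ x.2)
  have hCnot : C ∉ F '' (O \ T) := by
    rintro ⟨c, hc, h⟩
    exact map_induceInsertHom_ne G hv hc.2 h
  have := Set.ncard_le_ncard (Set.insert_subset hCodd hsub)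
  rw [Set.ncard_insert_of_notMem hCnot] at this
  rw [hTO] at hsplit
  lia

end AddVertex

/-- If `W` is a set of minimum cardinality among all sets satisfying
`q(V∖W) > |W|`, then every vertex `v ∈ W` has neighbors in at least 3 distinct
connected components of the induced subgraph `G[V∖W]`. -/
theorem min_tutte_violator_three_components {V : Type*} [Fintype V] [DecidableEq V]
    (G : SimpleGraph V) (W : Finset V)
    (hW : W.card < oddComponents G W)
    (hmin : ∀ W' : Finset V, W'.card < W.card → ¬ (W'.card < oddComponents G W'))
    (v : V) (hv : v ∈ W) :
    3 ≤ Nat.card {c : (G.induce ((↑W : Set V)ᶜ)).ConnectedComponent //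
        ∃ u : ((↑W : Set V)ᶜ : Set V), G.Adj v ↑u ∧
          (G.induce ((↑W : Set V)ᶜ)).connectedComponentMk u = c} := by
  have hodd (X : Finset V) : oddComponents G X =
      (G.induce ((↑X : Set V)ᶜ)).oddComponents.ncard := rfl
  have hcompl : ((↑(W.erase v) : Set V)ᶜ) = insert v ((↑W : Set V)ᶜ) := by
    ext x
    simp only [Finset.coe_erase, Set.mem_compl_iff, Set.mem_sdiff, Set.mem_insert_iff,
      Set.mem_singleton_iff]
    tauto
  change 3 ≤ (adjacentComponents G ((↑W : Set V)ᶜ) v).ncard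
  by_contra! hlt
  have hle := ncard_oddComponents_le_insert G (A := (↑W : Set V)ᶜ) (v := v)
    (by simpa using hv) (by lia)
  rw [← hcompl, ← hodd, ← hodd] at hle
  have hcard := Finset.card_erase_add_one hv
  exact hmin (W.erase v) (by lia) (by lia)
end

section
/- Let G be a finite simple graph on vertex set V, let W ⊆ V be a set of minimum cardinality among all sets satisfying q(V∖W) > |W|, and let C be the vertex set of any single connected component of the induced subgraph G[V∖W]. Then every vertex v ∈ W has at least 2 neighbors in V∖(W ∪ C); consequently, the number of edges of G with one endpoint in W and the other in V∖(W ∪ C) is at least 2|W|. -/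
open SimpleGraph

namespace SimpleGraph

variable {V : Type*} {G : SimpleGraph V} {s : Set V} {v : V}

/-- The inclusion of `G[s]` into `G[s ∪ {v}]`. -/
abbrev induceInsert (G : SimpleGraph V) (s : Set V) (v : V) :
    G.induce s ↪g G.induce (insert v s) :=
  G.induceHomOfLE (Set.subset_insert v s)

/-- The connected component of the added vertex `v` in `G[s ∪ {v}]`. -/
abbrev insertComponent (G : SimpleGraph V) (s : Set V) (v : V) :
    (G.induce (insert v s)).ConnectedComponent :=
  (G.induce (insert v s)).connectedComponentMk ⟨v, Set.mem_insert v s⟩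

/-- A component of `G[s]` touches `v` if it contains a neighbor of `v`. -/
def ConnectedComponent.Touches (c : (G.induce s).ConnectedComponent) (v : V) : Prop :=
  ∃ u ∈ c.supp, G.Adj v u

lemma exists_adj_or_reachable_of_walk {x y : ↥(insert v s)}
    (p : (G.induce (insert v s)).Walk x y) (a : s) (ha : induceInsert G s v a = x) :
    (∃ u : s, G.Adj v u ∧ (G.induce s).Reachable a u) ∨
      ∃ b : s, induceInsert G s v b = y ∧ (G.induce s).Reachable a b := by
  induction p generalizing a with
  | nil => exact .inr ⟨a, ha, .refl _⟩
  | @cons x z y h p ih =>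
    subst ha
    obtain ⟨z, rfl | hz⟩ := z
    · exact .inl ⟨a, h.symm, .refl _⟩
    · have hadj : (G.induce s).Adj a ⟨z, hz⟩ := h
      rcases ih ⟨z, hz⟩ rfl with ⟨u, hu, hr⟩ | ⟨b, hb, hr⟩
      · exact .inl ⟨u, hu, hadj.reachable.trans hr⟩
      · exact .inr ⟨b, hb, hadj.reachable.trans hr⟩

namespace ConnectedComponent

lemma Touches.map_eq {c : (G.induce s).ConnectedComponent} (hc : c.Touches v) :
    c.map (induceInsert G s v).toHom = insertComponent G s v := by
  obtain ⟨u, rfl, hu⟩ := hc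
  exact ConnectedComponent.sound (Adj.reachable hu.symm)

lemma touches_of_map_eq (hv : v ∉ s) {c : (G.induce s).ConnectedComponent}
    (hc : c.map (induceInsert G s v).toHom = insertComponent G s v) : c.Touches v := by
  induction c using ConnectedComponent.ind with
  | h a =>
    obtain ⟨p⟩ := ConnectedComponent.exact hc
    rcases exists_adj_or_reachable_of_walk p a rfl with ⟨u, hu, hr⟩ | ⟨b, hb, -⟩
    · exact ⟨u, ConnectedComponent.sound hr.symm, hu⟩
    · exact absurd ((show (b : V) = v from congrArg Subtype.val hb) ▸ b.2) hv

lemma reachable_of_not_touches {a b : s}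
    (ha : ¬ ((G.induce s).connectedComponentMk a).Touches v)
    (h : (G.induce (insert v s)).Reachable (induceInsert G s v a) (induceInsert G s v b)) :
    (G.induce s).Reachable a b := by
  obtain ⟨p⟩ := h
  rcases exists_adj_or_reachable_of_walk p a rfl with ⟨u, hu, hr⟩ | ⟨b', hb, hr⟩
  · exact absurd ⟨u, ConnectedComponent.sound hr.symm, hu⟩ ha
  · rwa [← (induceInsert G s v).injective hb]

lemma eq_of_map_eq_of_not_touches {c d : (G.induce s).ConnectedComponent}
    (hc : ¬ c.Touches v)
    (h : c.map (induceInsert G s v).toHom = d.map (induceInsert G s v).toHom) : c = d := by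
  induction c using ConnectedComponent.ind with
  | h a =>
    induction d using ConnectedComponent.ind with
    | h b =>
      exact ConnectedComponent.sound (reachable_of_not_touches hc (ConnectedComponent.exact h))

lemma supp_map_of_not_touches (hv : v ∉ s) {c : (G.induce s).ConnectedComponent}
    (hc : ¬ c.Touches v) :
    (c.map (induceInsert G s v).toHom).supp = induceInsert G s v '' c.supp := by
  ext ⟨x, hx⟩
  constructor
  · intro h
    obtain rfl | hxs := hx
    · exact absurd (touches_of_map_eq hv h.symm) hc
    · exact ⟨⟨x, hxs⟩, (eq_of_map_eq_of_not_touches hc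
        (d := (G.induce s).connectedComponentMk ⟨x, hxs⟩) h.symm).symm, rfl⟩
  · rintro ⟨a, rfl, h⟩
    rw [← h]
    rfl

lemma supp_insertComponent (hv : v ∉ s) :
    (insertComponent G s v).supp = insert ⟨v, Set.mem_insert v s⟩
      (induceInsert G s v '' {a | ((G.induce s).connectedComponentMk a).Touches v}) := by
  ext ⟨x, hx⟩
  constructor
  · intro h
    obtain rfl | hxs := hx
    · exact .inl rfl
    · exact .inr ⟨⟨x, hxs⟩, touches_of_map_eq hv h, rfl⟩
  · rintro (h | ⟨a, ha, h⟩)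
    · rw [h]
      rfl
    · rw [← h]
      exact ha.map_eq

lemma odd_ncard_supp_insertComponent [Finite V] (hv : v ∉ s)
    {c d : (G.induce s).ConnectedComponent} (hcd : c ≠ d) (hc : c.Touches v) (hd : d.Touches v)
    (h : ∀ e : (G.induce s).ConnectedComponent, e.Touches v → e = c ∨ e = d)
    (hco : Odd c.supp.ncard) (hdo : Odd d.supp.ncard) :
    Odd (insertComponent G s v).supp.ncard := by
  have hset : {a | ((G.induce s).connectedComponentMk a).Touches v} = c.supp ∪ d.supp := by
    ext a
    exact ⟨h _, by rintro (rfl | rfl) <;> assumption⟩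
  have hdisj : Disjoint c.supp d.supp :=
    Set.disjoint_left.mpr fun a hac had => hcd (hac.symm.trans had)
  rw [supp_insertComponent hv, hset, Set.ncard_insert_of_notMem _ (Set.toFinite _),
    Set.ncard_image_of_injective _ (induceInsert G s v).injective,
    Set.ncard_union_eq hdisj (Set.toFinite _) (Set.toFinite _)]
  · exact (hco.add_odd hdo).add_one
  · rintro ⟨a, -, ha⟩
    exact hv ((show (a : V) = v from congrArg Subtype.val ha) ▸ a.2)

end ConnectedComponent

open ConnectedComponent in
/-- Adding a vertex that touches at most two components decreases the number of odd components
by at most one. -/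
lemma ncard_oddComponents_induce_le [Finite V] (hv : v ∉ s)
    (c d : (G.induce s).ConnectedComponent)
    (h : ∀ e : (G.induce s).ConnectedComponent, e.Touches v → e = c ∨ e = d) :
    (G.induce s).oddComponents.ncard ≤ (G.induce (insert v s)).oddComponents.ncard + 1 := by
  set O := (G.induce s).oddComponents
  set O' := (G.induce (insert v s)).oddComponents
  set κ := insertComponent G s v
  let T : Set (G.induce s).ConnectedComponent := {e | e.Touches v}
  have hT : T ⊆ {c, d} := h
  have hsplit : (O ∩ T).ncard + (O \ T).ncard = O.ncard :=
    Set.ncard_inter_add_ncard_sdiff_eq_ncard O T (Set.toFinite _)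
  have hinj : (O \ T).ncard ≤ (O' \ {κ}).ncard := by
    refine Set.ncard_le_ncard_of_injOn (fun e => e.map (induceInsert G s v).toHom) ?_ ?_
      (Set.toFinite _)
    · rintro e ⟨he, heT⟩
      refine ⟨?_, fun hκ => heT (touches_of_map_eq hv hκ)⟩
      change Odd _
      rw [supp_map_of_not_touches hv heT,
        Set.ncard_image_of_injective _ (induceInsert G s v).injective]
      exact he
    · rintro e ⟨-, heT⟩ e' - hee
      exact eq_of_map_eq_of_not_touches heT hee
  by_cases hκ : κ ∈ O'
  · have h1 := Set.ncard_sdiff_singleton_add_one hκ (Set.toFinite _)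
    have h2 : (O ∩ T).ncard ≤ 2 :=
      (Set.ncard_le_ncard (Set.inter_subset_right.trans hT) (Set.toFinite _)).trans
        (by simpa using Set.ncard_insert_le c {d})
    omega
  · have h1 : (O' \ {κ}).ncard ≤ O'.ncard := Set.ncard_le_ncard Set.sdiff_subset (Set.toFinite _)
    have h2 : (O ∩ T).ncard ≤ 1 := by
      refine (Set.ncard_le_one (Set.toFinite _)).mpr fun e ⟨heO, heT⟩ e' ⟨heO', heT'⟩ => ?_
      by_contra hne
      refine hκ (odd_ncard_supp_insertComponent hv hne heT heT' (fun e'' he'' => ?_) heO heO')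
      have := hT heT
      have := hT heT'
      have := hT he''
      simp only [Set.mem_insert_iff, Set.mem_singleton_iff] at *
      grind
    omega

end SimpleGraph

lemma oddComponents_eq_ncard {V : Type*} [Fintype V] (G : SimpleGraph V) (W : Finset V) :
    _root_.oddComponents G W = (G.induce ((↑W : Set V)ᶜ)).oddComponents.ncard :=
  rfl

/-- If `W` is a set of minimum cardinality among all sets satisfying `q(V∖W) > |W|`
and `C` is the vertex set of a single connected component of `G[V∖W]`, then every
`v ∈ W` has at least 2 neighbors in `V∖(W ∪ C)`; consequently the number of edges
with one endpoint in `W` and the other in `V∖(W ∪ C)` is at least `2|W|`. -/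
theorem min_tutte_violator_edges_outside_component {V : Type*} [Fintype V] [DecidableEq V]
    (G : SimpleGraph V) (W : Finset V)
    (hW : W.card < oddComponents G W)
    (hmin : ∀ W' : Finset V, W'.card < W.card → ¬ (W'.card < oddComponents G W'))
    (c₀ : (G.induce ((↑W : Set V)ᶜ)).ConnectedComponent) (C : Set V)
    (hC : C = Subtype.val '' c₀.supp) :
    (∀ v ∈ W, 2 ≤ Nat.card {u : V // G.Adj v u ∧ u ∉ (↑W : Set V) ∪ C}) ∧
      2 * W.card ≤
        Nat.card {p : V × V // p.1 ∈ W ∧ p.2 ∉ (↑W : Set V) ∪ C ∧ G.Adj p.1 p.2} := by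
  have hdeg : ∀ v ∈ W, 2 ≤ Nat.card {u : V // G.Adj v u ∧ u ∉ (↑W : Set V) ∪ C} := by
    intro v hv
    by_contra! hlt
    have hsub : ∀ x y : {u : V // G.Adj v u ∧ u ∉ (↑W : Set V) ∪ C}, x = y :=
      (Finite.card_le_one_iff_subsingleton.mp (Nat.le_of_lt_succ hlt)).elim
    have hnotC : ∀ u : ((↑W : Set V)ᶜ : Set V), u ∉ c₀.supp → (u : V) ∉ (↑W : Set V) ∪ C := by
      rintro u hu (huW | huC)
      · exact u.2 huW
      · rw [hC] at huC
        exact hu ((Subtype.val_injective.mem_set_image).mp huC)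
    obtain ⟨d, hd⟩ : ∃ d : (G.induce ((↑W : Set V)ᶜ)).ConnectedComponent,
        ∀ e : (G.induce ((↑W : Set V)ᶜ)).ConnectedComponent, e.Touches v → e = c₀ ∨ e = d := by
      by_cases hex : ∃ d : (G.induce ((↑W : Set V)ᶜ)).ConnectedComponent, d.Touches v ∧ d ≠ c₀
      · obtain ⟨d, ⟨u, hud, hu⟩, hd⟩ := hex
        refine ⟨d, fun e ⟨w, hwe, hw⟩ => or_iff_not_imp_left.mpr fun he => ?_⟩
        have huw := hsub ⟨u, hu, hnotC u fun h => hd (hud.symm.trans h)⟩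
          ⟨w, hw, hnotC w fun h => he (hwe.symm.trans h)⟩
        have huw' : u = w := Subtype.ext (congrArg (fun x => x.1) huw)
        exact hwe.symm.trans (huw' ▸ hud)
      · push Not at hex
        exact ⟨c₀, fun e he => .inl (hex e he)⟩
    have hle := ncard_oddComponents_induce_le (s := (↑W : Set V)ᶜ) (by simpa using hv) c₀ d hd
    have hcompl : insert v ((↑W : Set V)ᶜ) = (↑(W.erase v) : Set V)ᶜ := by
      ext x
      simp only [Set.mem_insert_iff, Set.mem_compl_iff, Finset.mem_coe, Finset.mem_erase]
      tauto
    rw [hcompl, ← oddComponents_eq_ncard, ← oddComponents_eq_ncard] at hle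
    have hcard := Finset.card_erase_add_one hv
    exact hmin (W.erase v) (by omega) (by omega)
  refine ⟨hdeg, ?_⟩
  let e : {p : V × V // p.1 ∈ W ∧ p.2 ∉ (↑W : Set V) ∪ C ∧ G.Adj p.1 p.2} ≃
      Σ v : W, {u : V // G.Adj v u ∧ u ∉ (↑W : Set V) ∪ C} :=
    { toFun := fun p => ⟨⟨p.1.1, p.2.1⟩, p.1.2, p.2.2.2, p.2.2.1⟩
      invFun := fun q => ⟨(q.1, q.2.1), q.1.2, q.2.2.2, q.2.2.1⟩
      left_inv := fun _ => rfl
      right_inv := fun _ => rfl }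
  rw [Nat.card_congr e, Nat.card_sigma]
  calc 2 * W.card = ∑ _v : W, 2 := by simp [mul_comm]
    _ ≤ _ := Finset.sum_le_sum fun v _ => hdeg v v.2
end

section
/- Let G be a finite simple graph on vertex set V and let W ⊆ V be a set of maximum cardinality among all sets satisfying q(V∖W) > |W|. Then no connected component of the induced subgraph G[V∖W] having at least two vertices is a tree (i.e., every component of G[V∖W] with more than one vertex contains a cycle). -/
open SimpleGraph

/-- `S` is the vertex set of a connected component of `G[V∖W]`. -/
structure IsComponentAvoiding {V : Type*} (G : SimpleGraph V) (W S : Finset V) : Prop where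
  disjoint : Disjoint S W
  connected : (G.induce (S : Set V)).Connected
  closed : ∀ u ∈ S, ∀ v ∉ W, G.Adj u v → v ∈ S

namespace IsComponentAvoiding

variable {V : Type*} {G : SimpleGraph V} {W S : Finset V}

lemma of_supp [Fintype V] (c : (G.induce ((↑W : Set V)ᶜ)).ConnectedComponent)
    (hS : (S : Set V) = Subtype.val '' c.supp) : IsComponentAvoiding G W S where
  disjoint := by
    rw [← Finset.disjoint_coe, hS, Set.disjoint_left]
    rintro _ ⟨v, -, rfl⟩
    exact v.2
  connected := by
    rw [hS]
    let f : c.toSimpleGraph →g G.induce (Subtype.val '' c.supp) :=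
      ⟨fun v => ⟨v.1.1, v.1, v.2, rfl⟩, fun h => h⟩
    refine c.connected_toSimpleGraph.map f ?_
    rintro ⟨_, v, hv, rfl⟩
    exact ⟨⟨v, hv⟩, rfl⟩
  closed u hu v hv huv := by
    rw [← Finset.mem_coe, hS] at hu ⊢
    obtain ⟨u, hu, rfl⟩ := hu
    refine ⟨⟨v, hv⟩, ?_, rfl⟩
    exact c.mem_supp_of_adj_mem_supp hu huv

lemma exists_supp (h : IsComponentAvoiding G W S) :
    ∃ c : (G.induce ((↑W : Set V)ᶜ)).ConnectedComponent, (S : Set V) = Subtype.val '' c.supp := by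
  have hSW : ∀ v ∈ S, v ∈ (↑W : Set V)ᶜ := fun v hv hvW => Finset.disjoint_left.1 h.disjoint hv hvW
  obtain ⟨⟨s, hs⟩⟩ := h.connected.nonempty
  refine ⟨(G.induce ((↑W : Set V)ᶜ)).connectedComponentMk ⟨s, hSW s hs⟩, ?_⟩
  ext t
  constructor
  · intro ht
    refine ⟨⟨t, hSW t ht⟩, ?_, rfl⟩
    let f : G.induce (S : Set V) →g G.induce ((↑W : Set V)ᶜ) :=
      ⟨fun v => ⟨v.1, hSW v.1 v.2⟩, fun h => h⟩
    exact SimpleGraph.ConnectedComponent.eq.2 ((h.connected.preconnected ⟨t, ht⟩ ⟨s, hs⟩).map f)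
  · rintro ⟨t, ht, rfl⟩
    obtain ⟨p⟩ := (SimpleGraph.ConnectedComponent.eq.1 ht).symm
    have walk_mem : ∀ {a b : ((↑W : Set V)ᶜ : Set V)}, (G.induce ((↑W : Set V)ᶜ)).Walk a b →
        a.1 ∈ S → b.1 ∈ S := by
      intro a b p
      induction p with
      | nil => exact id
      | @cons _ v _ hadj _ ih => exact fun ha => ih (h.closed _ ha v.1 v.2 hadj)
    exact walk_mem p hs

end IsComponentAvoiding

lemma oddComponents_eq_ncard_s2 {V : Type*} [Fintype V] (G : SimpleGraph V) (W : Finset V) :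
    oddComponents G W = {S : Finset V | IsComponentAvoiding G W S ∧ Odd S.card}.ncard := by
  classical
  rw [_root_.oddComponents, ← Nat.card_coe_set_eq]
  have card_supp (c : (G.induce ((↑W : Set V)ᶜ)).ConnectedComponent) (S : Finset V)
      (hS : (S : Set V) = Subtype.val '' c.supp) : S.card = Nat.card c.supp := by
    rw [← Set.ncard_coe_finset, hS, Set.ncard_image_of_injective _ Subtype.val_injective,
      Nat.card_coe_set_eq]
  refine Nat.card_eq_of_bijective
    (fun c => ⟨(Subtype.val '' c.1.supp).toFinset, .of_supp c.1 (by simp), ?_⟩) ⟨?_, ?_⟩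
  · rw [card_supp c.1 _ (by simp)]
    exact c.2
  · intro c d hcd
    have h := congrArg (fun S => (S.1 : Set V)) hcd
    simp only [Set.coe_toFinset] at h
    exact Subtype.ext <| ConnectedComponent.supp_injective <|
      Set.image_injective.2 Subtype.val_injective h
  · rintro ⟨S, hS, hodd⟩
    obtain ⟨c, hc⟩ := hS.exists_supp
    refine ⟨⟨c, card_supp c S hc ▸ hodd⟩, Subtype.ext ?_⟩
    rw [← Finset.coe_inj, hc]
    simp

/-- Moving one side `A` of a bipartite component `A ∪ B` with `|A| ≤ |B|` into `W` raises the number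
of odd components by at least `|A|`: the vertices of `B` become isolated. -/
lemma oddComponents_add_card_le {V : Type*} [Fintype V] [DecidableEq V] {G : SimpleGraph V}
    {W A B : Finset V} (hK : IsComponentAvoiding G W (A ∪ B)) (hAB : Disjoint A B)
    (hcard : A.card ≤ B.card) (hB : ∀ u ∈ B, ∀ v ∈ B, ¬ G.Adj u v) :
    oddComponents G W + A.card ≤ oddComponents G (W ∪ A) := by
  rw [oddComponents_eq_ncard_s2, oddComponents_eq_ncard_s2]
  set Q := {S : Finset V | IsComponentAvoiding G W S ∧ Odd S.card}
  set Q' := {S : Finset V | IsComponentAvoiding G (W ∪ A) S ∧ Odd S.card}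
  have disjoint_of_ne {S : Finset V} (hS : IsComponentAvoiding G W S) (hne : S ≠ A ∪ B) :
      Disjoint S (A ∪ B) := by
    obtain ⟨c, hc⟩ := hS.exists_supp
    obtain ⟨d, hd⟩ := hK.exists_supp
    rw [← Finset.disjoint_coe, hc, hd, Set.disjoint_image_iff Subtype.val_injective]
    refine pairwise_disjoint_supp_connectedComponent _ fun hcd => hne ?_
    rw [← Finset.coe_inj, hc, hd, hcd]
  have old_subset : Q \ {A ∪ B} ⊆ Q' := by
    rintro S ⟨⟨hS, hodd⟩, hne⟩
    have hdisj := disjoint_of_ne hS hne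
    exact ⟨⟨Finset.disjoint_union_right.2 ⟨hS.disjoint, (Finset.disjoint_union_right.1 hdisj).1⟩,
      hS.connected, fun u hu v hv => hS.closed u hu v fun h => hv (Finset.mem_union_left _ h)⟩,
      hodd⟩
  have singleton_subset : (fun b : V => ({b} : Finset V)) '' B ⊆ Q' := by
    rintro _ ⟨b, hb, rfl⟩
    refine ⟨⟨?_, ?_, ?_⟩, by simp⟩
    · have h1 := Finset.disjoint_left.1 hK.disjoint (Finset.mem_union_right A hb)
      have h2 := Finset.disjoint_right.1 hAB hb
      simp [h1, h2]
    · have : Nonempty (({b} : Finset V) : Set V) := ⟨⟨b, Finset.mem_singleton_self b⟩⟩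
      have : Subsingleton (({b} : Finset V) : Set V) := by simp
      exact IsTree.of_subsingleton.connected
    · intro u hu v hv huv
      obtain rfl := Finset.mem_singleton.1 hu
      simp only [Finset.mem_union, not_or] at hv
      have hvK := hK.closed u (Finset.mem_union_right A hb) v hv.1 huv
      exact absurd huv (hB u hb v ((Finset.mem_union.1 hvK).resolve_left hv.2))
  have disjoint_new : Disjoint (Q \ {A ∪ B}) ((fun b : V => ({b} : Finset V)) '' B) := by
    rw [Set.disjoint_right]
    rintro _ ⟨b, hb, rfl⟩ ⟨⟨hS, -⟩, hne⟩
    exact Finset.disjoint_left.1 (disjoint_of_ne hS hne) (Finset.mem_singleton_self b)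
      (Finset.mem_union_right A hb)
  have card_le := Set.ncard_le_ncard (Set.union_subset old_subset singleton_subset)
  rw [Set.ncard_union_eq disjoint_new,
    Set.ncard_image_of_injective _ Finset.singleton_injective, Set.ncard_coe_finset] at card_le
  by_cases hKQ : A ∪ B ∈ Q
  · have hQ := Set.ncard_sdiff_singleton_add_one hKQ
    have hodd := hKQ.2
    rw [Finset.card_union_of_disjoint hAB] at hodd
    have : A.card ≠ B.card := fun h => by
      rw [h] at hodd
      exact Nat.not_odd_iff_even.2 ⟨_, rfl⟩ hodd
    omega
  · rw [Set.sdiff_singleton_eq_self hKQ] at card_le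
    omega

/-- If `W` is a set of maximum cardinality among all sets satisfying `q(V∖W) > |W|`,
then every connected component of `G[V∖W]` with at least two vertices contains a
cycle (i.e. no such component is a tree). -/
theorem max_tutte_violator_no_tree_component {V : Type*} [Fintype V] [DecidableEq V]
    (G : SimpleGraph V) (W : Finset V)
    (hW : W.card < oddComponents G W)
    (hmax : ∀ W' : Finset V, W.card < W'.card → ¬ (W'.card < oddComponents G W')) :
    ∀ c : (G.induce ((↑W : Set V)ᶜ)).ConnectedComponent, 2 ≤ Nat.card c.supp →
      ∃ (u : ((↑W : Set V)ᶜ : Set V)) (p : (G.induce ((↑W : Set V)ᶜ)).Walk u u),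
        (G.induce ((↑W : Set V)ᶜ)).connectedComponentMk u = c ∧ p.IsCycle := by
  classical
  intro c hc
  by_contra! hcycle
  have hacyclic : c.toSimpleGraph.IsAcyclic := by
    intro v p hp
    refine hcycle v.1 (p.map c.toSimpleGraph_hom) v.2 ?_
    exact hp.map Subtype.val_injective
  obtain ⟨C⟩ := hacyclic.colorable_two
  let side (i : Fin 2) : Finset V :=
    (Finset.univ.filter fun v : c.supp => C v = i).image fun v => v.1.1
  have side_union (i j : Fin 2) (hij : i ≠ j) :
      ((side i ∪ side j : Finset V) : Set V) = Subtype.val '' c.supp := by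
    have hcover (k : Fin 2) : k = i ∨ k = j := by omega
    ext v
    simp only [side, Finset.coe_union, Finset.coe_image, Finset.coe_filter, ← Set.image_union]
    constructor
    · rintro ⟨v, -, rfl⟩
      exact ⟨v.1, v.2, rfl⟩
    · rintro ⟨v, hv, rfl⟩
      exact ⟨⟨v, hv⟩, by simpa using hcover _, rfl⟩
  have side_disjoint (i j : Fin 2) (hij : i ≠ j) : Disjoint (side i) (side j) := by
    rw [Finset.disjoint_left]
    intro v hi hj
    simp only [side, Finset.mem_image, Finset.mem_filter, Finset.mem_univ, true_and] at hi hj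
    obtain ⟨u, rfl, rfl⟩ := hi
    obtain ⟨w, rfl, hw⟩ := hj
    exact hij (congrArg C (Subtype.ext (Subtype.ext hw))).symm
  have side_independent (i : Fin 2) : ∀ u ∈ side i, ∀ v ∈ side i, ¬ G.Adj u v := by
    intro u hu v hv huv
    simp only [side, Finset.mem_image, Finset.mem_filter, Finset.mem_univ, true_and] at hu hv
    obtain ⟨u, hu, rfl⟩ := hu
    obtain ⟨v, hv, rfl⟩ := hv
    exact C.valid (show c.toSimpleGraph.Adj u v from huv) (hu.trans hv.symm)
  have side_nonempty (i : Fin 2) : (side i).Nonempty := by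
    have : Nontrivial c.supp := Finite.one_lt_card_iff_nontrivial.1 hc
    obtain ⟨v⟩ := c.connected_toSimpleGraph.nonempty
    obtain ⟨w, hvw⟩ := c.connected_toSimpleGraph.preconnected.exists_adj_of_nontrivial v
    have hne := C.valid hvw
    have mem_side {x : c.supp} (hx : C x = i) : (side i).Nonempty :=
      ⟨x.1.1, Finset.mem_image_of_mem _ (by simpa using hx)⟩
    by_cases hv : C v = i
    · exact mem_side hv
    · exact mem_side (x := w) (by omega)
  have violator (i j : Fin 2) (hij : i ≠ j) (hle : (side i).card ≤ (side j).card) : False := by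
    have hK : IsComponentAvoiding G W (side i ∪ side j) := .of_supp c (side_union i j hij)
    have hq := oddComponents_add_card_le hK (side_disjoint i j hij) hle
      (side_independent j)
    have hcard : (W ∪ side i).card = W.card + (side i).card :=
      Finset.card_union_of_disjoint (Finset.disjoint_union_left.1 hK.disjoint).1.symm
    have hpos := (side_nonempty i).card_pos
    exact hmax (W ∪ side i) (by omega) (by omega)
  rcases le_total (side 0).card (side 1).card with h | h
  · exact violator 0 1 (by decide) h
  · exact violator 1 0 (by decide) h
end

section
/- Let H(x) = −x·log₂(x) − (1−x)·log₂(1−x) for x ∈ (0,1), with H(0) = H(1) = 0, and define f(x) = −x + (1+2x)·H(x/(1+2x)) − (1+2x) for x ≥ 0. Then f(x) ≤ −0.771 for every real x ≥ 0; moreover f attains its maximum on [0,∞) at the unique positive solution x* of 8x(1+x) = (1+2x)², namely x* = (√2 − 1)/2. -/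
/-- The binary entropy function, `H(x) = −x·log₂ x − (1−x)·log₂(1−x)`, with
`H(0) = H(1) = 0` (note `Real.logb 2 0 = 0`). -/
noncomputable def binEnt (x : ℝ) : ℝ :=
  -x * Real.logb 2 x - (1 - x) * Real.logb 2 (1 - x)

/-- `f(x) = −x + (1+2x)·H(x/(1+2x)) − (1+2x)`. -/
noncomputable def entDriftFn (x : ℝ) : ℝ :=
  -x + (1 + 2 * x) * binEnt (x / (1 + 2 * x)) - (1 + 2 * x)

/-- One term of Gibbs' inequality: `p·log₂ q − p·log₂ p ≤ (q − p)/log 2`. -/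
theorem mul_logb_sub_mul_logb_le {p q : ℝ} (hp : 0 ≤ p) (hq : 0 < q) :
    p * Real.logb 2 q - p * Real.logb 2 p ≤ (q - p) / Real.log 2 := by
  have h2 : 0 < Real.log 2 := Real.log_pos (by norm_num)
  have key : p * Real.log q - p * Real.log p ≤ q - p := by
    rcases hp.eq_or_lt with rfl | hp
    · simpa using hq.le
    · have h := mul_le_mul_of_nonneg_left (Real.log_le_sub_one_of_pos (div_pos hq hp)) hp.le
      rw [Real.log_div hq.ne' hp.ne', mul_sub, mul_sub, mul_div_cancel₀ _ hp.ne'] at h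
      linarith
  have h := div_le_div_of_nonneg_right key h2.le
  simp only [Real.logb]
  calc _ = (p * Real.log q - p * Real.log p) / Real.log 2 := by ring
    _ ≤ _ := h

/-- Entropy is at most cross-entropy. -/
theorem binEnt_le_crossEntropy {p q : ℝ} (hp : 0 ≤ p) (hp' : p ≤ 1) (hq : 0 < q) (hq' : q < 1) :
    binEnt p ≤ -p * Real.logb 2 q - (1 - p) * Real.logb 2 (1 - q) := by
  have h := mul_logb_sub_mul_logb_le hp hq
  have h' := mul_logb_sub_mul_logb_le (sub_nonneg.2 hp') (sub_pos.2 hq')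
  have e : (q - p) / Real.log 2 + (1 - q - (1 - p)) / Real.log 2 = 0 := by ring
  unfold binEnt
  linarith

theorem logb_two_sub_sqrt_two_div_four :
    Real.logb 2 ((2 - √2) / 4) = Real.logb 2 (2 - √2) - 2 := by
  have h : 2 - √2 ≠ 0 := by
    have := Real.sqrt_two_lt_three_halves
    linarith
  rw [Real.logb_div h (by norm_num), show (4 : ℝ) = 2 ^ (2 : ℕ) by norm_num, Real.logb_pow,
    Real.logb_self_eq_one (by norm_num)]
  norm_num

theorem logb_one_sub_two_sub_sqrt_two_div_four :
    Real.logb 2 (1 - (2 - √2) / 4) = -1 - Real.logb 2 (2 - √2) := by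
  have h : 2 - √2 ≠ 0 := by
    have := Real.sqrt_two_lt_three_halves
    linarith
  have e : 1 - (2 - √2) / 4 = 2⁻¹ / (2 - √2) := by
    rw [eq_div_iff h]
    nlinarith [Real.sq_sqrt (show (0 : ℝ) ≤ 2 by norm_num)]
  rw [e, Real.logb_div (by norm_num) h, Real.logb_inv, Real.logb_self_eq_one (by norm_num)]

/-- Replacing the entropy in `entDriftFn` by the cross-entropy relative to `(2 − √2)/4` gives a
constant. -/
theorem crossEntropy_drift_eq {x : ℝ} (hx : 0 ≤ x) :
    -x + (1 + 2 * x) * (-(x / (1 + 2 * x)) * Real.logb 2 ((2 - √2) / 4)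
      - (1 - x / (1 + 2 * x)) * Real.logb 2 (1 - (2 - √2) / 4)) - (1 + 2 * x)
      = Real.logb 2 (2 - √2) := by
  rw [logb_two_sub_sqrt_two_div_four, logb_one_sub_two_sub_sqrt_two_div_four]
  have h : 1 + 2 * x ≠ 0 := by positivity
  field_simp
  ring

theorem entDriftFn_le_logb {x : ℝ} (hx : 0 ≤ x) : entDriftFn x ≤ Real.logb 2 (2 - √2) := by
  have h : 0 < 1 + 2 * x := by positivity
  have hs := Real.sqrt_two_lt_three_halves
  have hs' := Real.sqrt_nonneg 2
  rw [← crossEntropy_drift_eq hx, entDriftFn]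
  gcongr
  exact binEnt_le_crossEntropy (by positivity) ((div_le_one h).2 (by linarith))
    (by linarith) (by linarith)

theorem entDriftFn_sqrt_two_sub_one_div_two :
    entDriftFn ((√2 - 1) / 2) = Real.logb 2 (2 - √2) := by
  have h : 0 ≤ (√2 - 1) / 2 := by
    have := Real.one_lt_sqrt_two
    linarith
  have e : (√2 - 1) / 2 / (1 + 2 * ((√2 - 1) / 2)) = (2 - √2) / 4 := by
    rw [div_eq_iff (by positivity)]
    nlinarith [Real.sq_sqrt (show (0 : ℝ) ≤ 2 by norm_num)]
  rw [← crossEntropy_drift_eq h, entDriftFn, binEnt, e]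

theorem logb_two_sub_sqrt_two_le : Real.logb 2 (2 - √2) ≤ -(771 / 1000) := by
  have hs : (1.41421 : ℝ) ≤ √2 := Real.le_sqrt_of_sq_le (by norm_num)
  have hs' := Real.sqrt_two_lt_three_halves
  have hpos : 0 < 2 - √2 := by linarith
  have hpow : (2 - √2) ^ 35 ≤ ((2 : ℝ) ^ 27)⁻¹ :=
    calc (2 - √2) ^ 35 ≤ (0.58579 : ℝ) ^ 35 := by
          gcongr
          linarith
      _ ≤ _ := by norm_num
  have h := Real.logb_le_logb_of_le (b := 2) (by norm_num) (by positivity) hpow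
  rw [Real.logb_inv, Real.logb_pow, Real.logb_pow, Real.logb_self_eq_one (by norm_num)] at h
  norm_num at h
  linarith

/-- `f(x) ≤ −0.771` for all `x ≥ 0`; `f` attains its maximum on `[0,∞)` at the unique
positive solution `x* = (√2 − 1)/2` of `8x(1+x) = (1+2x)²`. -/
theorem entropy_drift_bound :
    (∀ x : ℝ, 0 ≤ x → entDriftFn x ≤ -(771 / 1000)) ∧
      (∀ x : ℝ, 0 ≤ x → entDriftFn x ≤ entDriftFn ((Real.sqrt 2 - 1) / 2)) ∧
      (∀ x : ℝ, 0 < x →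
        (8 * x * (1 + x) = (1 + 2 * x) ^ 2 ↔ x = (Real.sqrt 2 - 1) / 2)) := by
  refine ⟨fun x hx => (entDriftFn_le_logb hx).trans logb_two_sub_sqrt_two_le,
    fun x hx => (entDriftFn_le_logb hx).trans_eq entDriftFn_sqrt_two_sub_one_div_two.symm,
    fun x hx => ⟨fun h => ?_, ?_⟩⟩
  · have e : √2 = 1 + 2 * x := by
      rw [Real.sqrt_eq_iff_mul_self_eq (by norm_num) (by positivity)]
      linarith
    rw [e]
    ring
  · rintro rfl
    nlinarith [Real.sq_sqrt (show (0 : ℝ) ≤ 2 by norm_num)]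
end

section
/- Let a be a real number with 0 < a ≤ 1/2 such that 2^{1.229}·√(1 − 11a/6) ≤ 1. Then exp(2^{1.229}·√(1 − 11a/6)) · a · (1−2a)^{(1−2a)/(2a)} ≤ 99/100, where for a = 1/2 the expression (1−2a)^{(1−2a)/(2a)} = 0^0 is interpreted as 1. -/
set_option exponentiation.threshold 2000 in
/-- Numerical bounds on the square of `2^{1.229}`. -/
lemma two_rpow_sq_bounds :
    5.49 ≤ ((2 : ℝ) ^ (1.229 : ℝ)) ^ 2 ∧ ((2 : ℝ) ^ (1.229 : ℝ)) ^ 2 ≤ 5.496 := by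
  have h : (((2 : ℝ) ^ (1.229 : ℝ)) ^ 2) ^ 500 = 2 ^ 1229 := by
    rw [← pow_mul, ← Real.rpow_natCast, ← Real.rpow_mul (by norm_num), ← Real.rpow_natCast]
    norm_num
  constructor
  · refine le_of_pow_le_pow_left₀ (n := 500) (by norm_num) (by positivity) ?_
    rw [h]
    norm_num
  · refine le_of_pow_le_pow_left₀ (n := 500) (by norm_num) (by norm_num) ?_
    rw [h]
    norm_num

lemma log_le_neg_of_le {t : ℝ} (ht : 0 < t) (ht' : t ≤ 0.1078) : Real.log t ≤ -2.22 := by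
  rw [Real.log_le_iff_le_exp ht]
  refine ht'.trans ?_
  have h : Real.exp 2.22 ≤ 1 / 0.1078 := by
    refine le_of_pow_le_pow_left₀ (n := 50) (by norm_num) (by norm_num) ?_
    have h1 : Real.exp 2.22 ^ 50 = Real.exp 1 ^ 111 := by
      rw [← Real.exp_nat_mul, ← Real.exp_nat_mul]
      norm_num
    rw [h1]
    refine (pow_le_pow_left₀ (Real.exp_pos 1).le Real.exp_one_lt_d9.le 111).trans ?_
    norm_num
  rw [Real.exp_neg, le_inv_comm₀ (by norm_num) (Real.exp_pos _)]
  simpa using h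

lemma rpow_div_one_sub_le_exp {t : ℝ} (ht : 0 ≤ t) (ht' : t ≤ 0.1078) :
    t ^ (t / (1 - t)) ≤ Real.exp (-2.22 * (t + t ^ 2)) := by
  rcases ht.eq_or_lt with rfl | hpos
  · simp
  · rw [Real.rpow_def_of_pos hpos, Real.exp_le_exp]
    have hlog := log_le_neg_of_le hpos ht'
    have hdiv : t + t ^ 2 ≤ t / (1 - t) := by
      rw [le_div_iff₀ (by linarith)]
      nlinarith [pow_pos hpos 3]
    nlinarith [pow_pos hpos 2]

/-- If `0 < a ≤ 1/2` and `2^{1.229}·√(1 − 11a/6) ≤ 1`, then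
`exp(2^{1.229}·√(1 − 11a/6)) · a · (1−2a)^{(1−2a)/(2a)} ≤ 99/100`
(with the real-power convention `0^0 = 1`). -/
theorem numerical_case_g_le_e (a : ℝ) (ha : 0 < a) (ha2 : a ≤ 1 / 2)
    (hg : (2 : ℝ) ^ (1.229 : ℝ) * Real.sqrt (1 - 11 * a / 6) ≤ 1) :
    Real.exp ((2 : ℝ) ^ (1.229 : ℝ) * Real.sqrt (1 - 11 * a / 6)) * a *
        (1 - 2 * a) ^ ((1 - 2 * a) / (2 * a)) ≤ 99 / 100 := by
  obtain ⟨hc1, hc2⟩ := two_rpow_sq_bounds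
  set c := (2 : ℝ) ^ (1.229 : ℝ)
  set s := c * Real.sqrt (1 - 11 * a / 6) with hs
  obtain ⟨t, rfl⟩ : ∃ t, a = (1 - t) / 2 := ⟨1 - 2 * a, by ring⟩
  have ht : 0 ≤ t := by linarith
  have hs0 : 0 ≤ s := by positivity
  have hs2 : s ^ 2 = c ^ 2 * ((1 + 11 * t) / 12) := by
    rw [hs, mul_pow, Real.sq_sqrt (by linarith)]
    ring
  have ht' : t ≤ 0.1078 := by nlinarith
  have hs_le : s ≤ (5.496 * ((1 + 11 * t) / 12) + 0.75 ^ 2) / 1.5 := by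
    have hs2_le : s ^ 2 ≤ 5.496 * ((1 + 11 * t) / 12) := by
      rw [hs2]
      gcongr
    rw [le_div_iff₀ (by norm_num)]
    linarith [sq_nonneg (s - 0.75)]
  have hlog : Real.log ((1 - t) / 2) ≤ -t - 0.6931471803 := by
    rw [Real.log_div (by linarith) (by norm_num)]
    linarith [Real.log_le_sub_one_of_pos (show 0 < 1 - t by linarith), Real.log_two_gt_d9]
  have hlog99 := Real.one_sub_inv_le_log_of_pos (show (0 : ℝ) < 99 / 100 by norm_num)
  have hpow := rpow_div_one_sub_le_exp ht ht'
  rw [show 1 - 2 * ((1 - t) / 2) = t by ring, show 2 * ((1 - t) / 2) = 1 - t by ring]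
  calc Real.exp s * ((1 - t) / 2) * t ^ (t / (1 - t))
      ≤ Real.exp s * ((1 - t) / 2) * Real.exp (-2.22 * (t + t ^ 2)) := by gcongr
    _ = Real.exp (s + Real.log ((1 - t) / 2) + -2.22 * (t + t ^ 2)) := by
      rw [Real.exp_add, Real.exp_add, Real.exp_log ha]
    _ ≤ Real.exp (Real.log (99 / 100)) := by
      rw [Real.exp_le_exp]
      norm_num at hlog99 hs_le ⊢
      nlinarith [sq_nonneg (t - 0.031)]
    _ = 99 / 100 := Real.exp_log (by norm_num)
end

section
/- Let a be a real number with 0 < a ≤ 1/2. Then 2^{1.229} · e · √(1 − 11a/6) · a · (1−2a)^{(1−2a)/(2a)} ≤ 19/20, where for a = 1/2 the expression (1−2a)^{(1−2a)/(2a)} = 0^0 is interpreted as 1 and e is Euler's number. -/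
theorem two_rpow_mul_exp_one_sq_le :
    ((2 : ℝ) ^ (1.229 : ℝ) * Real.exp 1) ^ 2 ≤ 40.67 := by
  have h2 : (2 : ℝ) ^ (1.229 : ℝ) ≤ 2.346 := by
    have h : ((2 : ℝ) ^ (1.23 : ℝ)) ^ 100 ≤ 2.346 ^ 100 := by
      rw [← Real.rpow_natCast, ← Real.rpow_mul (by norm_num)]
      have : (1.23 : ℝ) * ((100 : ℕ) : ℝ) = ((123 : ℕ) : ℝ) := by norm_num
      rw [this, Real.rpow_natCast]
      norm_num
    exact (Real.rpow_le_rpow_of_exponent_le (by norm_num) (by norm_num)).trans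
      (le_of_pow_le_pow_left₀ (by norm_num) (by norm_num) h)
  have he : Real.exp 1 ≤ 2.71829 := by linarith [Real.exp_one_lt_d9]
  calc ((2 : ℝ) ^ (1.229 : ℝ) * Real.exp 1) ^ 2 ≤ (2.346 * 2.71829) ^ 2 := by gcongr
    _ ≤ 40.67 := by norm_num

theorem exp_five_halves_le : Real.exp (5 / 2) ≤ 12.19 := by
  have h : Real.exp (5 / 2) ^ 2 ≤ 12.19 ^ 2 := by
    rw [← Real.exp_nat_mul, show ((2 : ℕ) : ℝ) * (5 / 2) = (5 : ℕ) * 1 by norm_num,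
      Real.exp_nat_mul]
    calc Real.exp 1 ^ 5 ≤ 2.71829 ^ 5 := by
          gcongr
          linarith [Real.exp_one_lt_d9]
      _ ≤ 12.19 ^ 2 := by norm_num
  exact le_of_pow_le_pow_left₀ (by norm_num) (by norm_num) h

theorem exp_seven_quarters_le : Real.exp (7 / 4) ≤ 5.76 := by
  have h : Real.exp (7 / 4) ^ 4 ≤ 5.76 ^ 4 := by
    rw [← Real.exp_nat_mul, show ((4 : ℕ) : ℝ) * (7 / 4) = (7 : ℕ) * 1 by norm_num,
      Real.exp_nat_mul]
    calc Real.exp 1 ^ 7 ≤ 2.71829 ^ 7 := by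
          gcongr
          linarith [Real.exp_one_lt_d9]
      _ ≤ 5.76 ^ 4 := by norm_num
  exact le_of_pow_le_pow_left₀ (by norm_num) (by norm_num) h

/-- The tangent line bound for `log` at `exp (-s)`. -/
theorem log_le_mul_sub {b s E : ℝ} (hb : 0 < b) (hE : Real.exp s ≤ E) :
    Real.log b ≤ E * b - 1 - s := by
  have h := Real.log_le_sub_one_of_pos (mul_pos hb (Real.exp_pos s))
  rw [Real.log_mul hb.ne' (Real.exp_pos s).ne', Real.log_exp] at h
  nlinarith

theorem log_le_two_mul_div {b : ℝ} (hb : 0 < b) (hb1 : b ≤ 1) :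
    Real.log b ≤ -(2 * (1 - b) / (1 + b)) := by
  have h := Real.le_log_one_add_of_nonneg (x := b⁻¹ - 1)
    (by linarith [(one_le_inv₀ hb).2 hb1])
  rw [add_sub_cancel, Real.log_inv] at h
  have e : 2 * (b⁻¹ - 1) / (b⁻¹ - 1 + 2) = 2 * (1 - b) / (1 + b) := by
    have : b⁻¹ - 1 + 2 = (1 + b) / b := by field_simp; ring
    rw [this]
    field_simp
  linarith

theorem rpow_div_one_sub_sq_mul_le_one {b y : ℝ} (hb : 0 ≤ b) (hb1 : b < 1) (hy : 0 ≤ y)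
    (h0 : b = 0 → y = 0) (h : 0 < b → y * (1 - b) ≤ -(2 * b * Real.log b)) :
    (b ^ (b / (1 - b))) ^ 2 * (1 + y + y ^ 2 / 2) ≤ 1 := by
  have hT : (b ^ (b / (1 - b))) ^ 2 ≤ Real.exp (-y) := by
    rcases hb.eq_or_lt with rfl | hb
    · simp [h0 rfl]
    · rw [Real.rpow_def_of_pos hb, ← Real.exp_nat_mul, Real.exp_le_exp]
      have h1 : 0 < 1 - b := by linarith
      have : y ≤ -(2 * b * Real.log b) / (1 - b) := (le_div_iff₀ h1).2 (h hb)
      calc ((2 : ℕ) : ℝ) * (Real.log b * (b / (1 - b)))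
          = -(-(2 * b * Real.log b) / (1 - b)) := by push_cast; ring
        _ ≤ -y := neg_le_neg this
  calc (b ^ (b / (1 - b))) ^ 2 * (1 + y + y ^ 2 / 2)
      ≤ Real.exp (-y) * Real.exp y := by
        gcongr
        exact Real.quadratic_le_exp_of_nonneg hy
    _ = 1 := by rw [← Real.exp_add]; simp

/-- A quadratic Taylor bound of `exp y`, with `y` a lower bound for `-2b log b / (1 - b)`, dominates
the polynomial factor. -/
theorem exists_exponent_bound {b : ℝ} (hb : 0 ≤ b) (hb1 : b < 1) :
    ∃ y : ℝ, 0 ≤ y ∧ (b = 0 → y = 0) ∧ (0 < b → y * (1 - b) ≤ -(2 * b * Real.log b)) ∧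
      40.67 * ((1 + 11 * b) * (1 - b) ^ 2 / 48) ≤ (19 / 20) ^ 2 * (1 + y + y ^ 2 / 2) := by
  rcases le_total b 0.12 with h1 | h1
  · refine ⟨2 * b * (1 + b) * (3.5 - 12.19 * b), ?_, ?_, ?_, ?_⟩
    · have : 0 ≤ 3.5 - 12.19 * b := by linarith
      positivity
    · rintro rfl
      simp
    · intro hb0
      have hl := log_le_mul_sub hb0 exp_five_halves_le
      have h3 : 0 ≤ 3.5 - 12.19 * b := by linarith
      nlinarith [mul_le_mul_of_nonneg_left hl hb, mul_nonneg (pow_nonneg hb 3) h3]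
    · have hy : 7 * b - 20.31 * b ^ 2 ≤ 2 * b * (1 + b) * (3.5 - 12.19 * b) := by
        nlinarith [mul_nonneg (sq_nonneg b) (sub_nonneg.2 h1)]
      generalize 2 * b * (1 + b) * (3.5 - 12.19 * b) = y at hy ⊢
      nlinarith [sq_nonneg (y - 0.45), mul_nonneg hb (sub_nonneg.2 h1),
        mul_nonneg (sq_nonneg b) (sub_nonneg.2 h1), sq_nonneg (b - 0.07),
        mul_nonneg hb (sq_nonneg (b - 0.07))]
  rcases le_total b 0.22 with h2 | h2
  · refine ⟨2 * b * (1 + b) * (2.75 - 5.76 * b), ?_, ?_, ?_, ?_⟩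
    · have : 0 ≤ 2.75 - 5.76 * b := by linarith
      positivity
    · rintro rfl
      simp
    · intro hb0
      have hl := log_le_mul_sub hb0 exp_seven_quarters_le
      have h3 : 0 ≤ 2.75 - 5.76 * b := by linarith
      nlinarith [mul_le_mul_of_nonneg_left hl hb, mul_nonneg (pow_nonneg hb 3) h3]
    · generalize hy : 2 * b * (1 + b) * (2.75 - 5.76 * b) = y
      nlinarith [sq_nonneg (y - 0.6), mul_nonneg (sub_nonneg.2 h1) (sub_nonneg.2 h2),
        mul_nonneg hb (mul_nonneg (sub_nonneg.2 h1) (sub_nonneg.2 h2)),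
        sq_nonneg (b - 0.15), mul_nonneg hb (sq_nonneg (b - 0.15))]
  · have hp : 0 < 1 + b := by linarith
    refine ⟨4 * b / (1 + b), by positivity, ?_, ?_, ?_⟩
    · rintro rfl
      simp
    · intro hb0
      have hl := mul_le_mul_of_nonneg_left (log_le_two_mul_div hb0 hb1.le) hb
      have e : 4 * b / (1 + b) * (1 - b) = 2 * (b * (2 * (1 - b) / (1 + b))) := by ring
      rw [e]
      linarith
    · have e : 1 + 4 * b / (1 + b) + (4 * b / (1 + b)) ^ 2 / 2
          = (1 + 6 * b + 13 * b ^ 2) / (1 + b) ^ 2 := by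
        field_simp
        ring
      rw [e, ← mul_div_assoc ((19 / 20 : ℝ) ^ 2), le_div_iff₀ (by positivity)]
      obtain ⟨c, rfl⟩ : ∃ c, b = 0.22 + c := ⟨b - 0.22, by ring⟩
      have hc : 0 ≤ c := by linarith
      have hc1 : 0 ≤ 0.78 - c := by linarith
      nlinarith [pow_nonneg hc 2, pow_nonneg hc 3, pow_nonneg hc 4, pow_nonneg hc 5,
        mul_nonneg hc hc1, mul_nonneg (pow_nonneg hc 2) hc1]

/-- For `0 < a ≤ 1/2`,
`2^{1.229} · e · √(1 − 11a/6) · a · (1−2a)^{(1−2a)/(2a)} ≤ 19/20`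
(with the real-power convention `0^0 = 1`). -/
theorem numerical_case_g_ge_e (a : ℝ) (ha : 0 < a) (ha2 : a ≤ 1 / 2) :
    (2 : ℝ) ^ (1.229 : ℝ) * Real.exp 1 * Real.sqrt (1 - 11 * a / 6) * a *
        (1 - 2 * a) ^ ((1 - 2 * a) / (2 * a)) ≤ 19 / 20 := by
  obtain ⟨b, rfl⟩ : ∃ b, a = (1 - b) / 2 := ⟨1 - 2 * a, by ring⟩
  have hb : 0 ≤ b := by linarith
  have hb1 : b < 1 := by linarith
  rw [show 1 - 2 * ((1 - b) / 2) = b by ring, show 2 * ((1 - b) / 2) = 1 - b by ring]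
  obtain ⟨y, hy, h0, h, hq⟩ := exists_exponent_bound hb hb1
  have hT := rpow_div_one_sub_sq_mul_le_one hb hb1 hy h0 h
  set T := b ^ (b / (1 - b))
  refine abs_le_of_sq_le_sq' ?_ (by norm_num) |>.2
  have hs : Real.sqrt (1 - 11 * ((1 - b) / 2) / 6) ^ 2 = (1 + 11 * b) / 12 := by
    rw [Real.sq_sqrt (by linarith)]
    ring
  have hq0 : 0 ≤ (1 + 11 * b) * (1 - b) ^ 2 / 48 := by positivity
  calc ((2 : ℝ) ^ (1.229 : ℝ) * Real.exp 1 * Real.sqrt (1 - 11 * ((1 - b) / 2) / 6) *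
        ((1 - b) / 2) * T) ^ 2
      = ((2 : ℝ) ^ (1.229 : ℝ) * Real.exp 1) ^ 2 * ((1 + 11 * b) * (1 - b) ^ 2 / 48) * T ^ 2 := by
        rw [mul_pow, mul_pow, mul_pow _ (Real.sqrt _), hs]
        ring
    _ ≤ 40.67 * ((1 + 11 * b) * (1 - b) ^ 2 / 48) * T ^ 2 := by
        gcongr
        exact two_rpow_mul_exp_one_sq_le
    _ ≤ (19 / 20) ^ 2 * (1 + y + y ^ 2 / 2) * T ^ 2 := by gcongr
    _ = (19 / 20) ^ 2 * (T ^ 2 * (1 + y + y ^ 2 / 2)) := by ring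
    _ ≤ (19 / 20) ^ 2 := mul_le_of_le_one_right (by norm_num) hT
end
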